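/- The special linear group of 2×2 matrices over the ring 𝔽₂[x]/(x²) of dual numbers over the field with two elements is isomorphic, as a group, to the direct product of the symmetric group on four letters with a cyclic group of order two: SL₂(𝔽₂[x]/(x²)) ≅ S₄ × ℤ/2ℤ. -/

import Mathlib

open Matrix TrivSqZeroExt

/-- The determinant condition on an element of `SL₂` over the dual numbers, in degree zero. -/
theorem sl2_dualNumber_det_fst (g : SpecialLinearGroup (Fin 2) (DualNumber (ZMod 2))) :
    (g 0 0).fst * (g 1 1).fst - (g 0 1).fst * (g 1 0).fst = 1 := by
  have h : g 0 0 * g 1 1 - g 0 1 * g 1 0 = 1 := by rw [← det_fin_two]; exact g.2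
  simpa using congrArg fst h

/-- The determinant condition on an element of `SL₂` over the dual numbers, in degree one. -/
theorem sl2_dualNumber_det_snd (g : SpecialLinearGroup (Fin 2) (DualNumber (ZMod 2))) :
    (g 0 0).fst * (g 1 1).snd + (g 0 0).snd * (g 1 1).fst
      - ((g 0 1).fst * (g 1 0).snd + (g 0 1).snd * (g 1 0).fst) = 0 := by
  have h : g 0 0 * g 1 1 - g 0 1 * g 1 0 = 1 := by rw [← det_fin_two]; exact g.2
  simpa using congrArg snd h

theorem sl2_dualNumber_fst_mul (g h : SpecialLinearGroup (Fin 2) (DualNumber (ZMod 2)))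
    (i j : Fin 2) :
    ((g * h) i j).fst = (g i 0).fst * (h 0 j).fst + (g i 1).fst * (h 1 j).fst := by
  have e : (g * h) i j = g i 0 * h 0 j + g i 1 * h 1 j :=
    (mul_apply (M := g.1) (N := h.1)).trans (Fin.sum_univ_two _)
  simpa using congrArg fst e

theorem sl2_dualNumber_snd_mul (g h : SpecialLinearGroup (Fin 2) (DualNumber (ZMod 2)))
    (i j : Fin 2) :
    ((g * h) i j).snd = (g i 0).fst * (h 0 j).snd + (g i 0).snd * (h 0 j).fst
      + ((g i 1).fst * (h 1 j).snd + (g i 1).snd * (h 1 j).fst) := by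
  have e : (g * h) i j = g i 0 * h 0 j + g i 1 * h 1 j :=
    (mul_apply (M := g.1) (N := h.1)).trans (Fin.sum_univ_two _)
  simpa using congrArg snd e

theorem zmod_two_mul_self (a : ZMod 2) : a * a = a := by
  revert a; decide

/-- The affine action of `g₀ + ε g₁ ∈ SL₂(𝔽₂[ε])` on `𝔽₂²`: the linear part is `g₀`, and the
translation part consists of the off-diagonal entries of `g₁ g₀⁻¹`. -/
def sl2DualNumberAct (g : SpecialLinearGroup (Fin 2) (DualNumber (ZMod 2)))
    (v : ZMod 2 × ZMod 2) : ZMod 2 × ZMod 2 :=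
  ((g 0 0).fst * v.1 + (g 0 1).fst * v.2
      + ((g 0 0).snd * (g 0 1).fst + (g 0 1).snd * (g 0 0).fst),
    (g 1 0).fst * v.1 + (g 1 1).fst * v.2
      + ((g 1 0).snd * (g 1 1).fst + (g 1 1).snd * (g 1 0).fst))

/-- `sl2DualNumberAct` as a monoid homomorphism. -/
def sl2DualNumberAffine :
    SpecialLinearGroup (Fin 2) (DualNumber (ZMod 2)) →* Function.End (ZMod 2 × ZMod 2) where
  toFun := sl2DualNumberAct
  map_one' := by
    funext v
    simp [sl2DualNumberAct, Function.End.one_def]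
  map_mul' g h := by
    funext v
    have h₀ := sl2_dualNumber_det_fst h
    have h₁ := sl2_dualNumber_det_snd h
    have two : ∀ x : ZMod 2, x + x = 0 := by decide
    have sq := zmod_two_mul_self
    change sl2DualNumberAct (g * h) v = sl2DualNumberAct g (sl2DualNumberAct h v)
    simp only [sl2DualNumberAct, sl2_dualNumber_fst_mul,
      sl2_dualNumber_snd_mul, Prod.mk.injEq]
    generalize (g 0 0).fst = a0, (g 0 1).fst = b0, (g 1 0).fst = c0, (g 1 1).fst = d0,
      (g 0 0).snd = a1, (g 0 1).snd = b1, (g 1 0).snd = c1, (g 1 1).snd = d1 at *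
    generalize (h 0 0).fst = p0, (h 0 1).fst = q0, (h 1 0).fst = r0, (h 1 1).fst = s0,
      (h 0 0).snd = p1, (h 0 1).snd = q1, (h 1 0).snd = r1, (h 1 1).snd = s1 at *
    constructor
    · have := sq a0
      have := sq b0
      grind
    · have := sq c0
      have := sq d0
      grind

/-- The character of `SL₂(𝔽₂[ε])` sending `g₀ + ε g₁` to the value at `g₁ g₀⁻¹` of the
conjugation-invariant functional `[[a, b], [c, a]] ↦ a + b + c` on `𝔰𝔩₂(𝔽₂)`. -/
def sl2DualNumberCharacter :
    SpecialLinearGroup (Fin 2) (DualNumber (ZMod 2)) →* Multiplicative (ZMod 2) where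
  toFun g := Multiplicative.ofAdd
    ((g 0 0).snd * (g 1 1).fst + (g 0 1).snd * (g 1 0).fst
      + ((g 0 0).snd * (g 0 1).fst + (g 0 1).snd * (g 0 0).fst)
      + ((g 1 0).snd * (g 1 1).fst + (g 1 1).snd * (g 1 0).fst))
  map_one' := by simp
  map_mul' g h := by
    rw [← ofAdd_add]
    have g₀ := sl2_dualNumber_det_fst g
    have g₁ := sl2_dualNumber_det_snd g
    have h₀ := sl2_dualNumber_det_fst h
    have h₁ := sl2_dualNumber_det_snd h
    simp only [sl2_dualNumber_fst_mul,
      sl2_dualNumber_snd_mul, EmbeddingLike.apply_eq_iff_eq]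
    generalize (g 0 0).fst = a0, (g 0 1).fst = b0, (g 1 0).fst = c0, (g 1 1).fst = d0,
      (g 0 0).snd = a1, (g 0 1).snd = b1, (g 1 0).snd = c1, (g 1 1).snd = d1 at *
    generalize (h 0 0).fst = p0, (h 0 1).fst = q0, (h 1 0).fst = r0, (h 1 1).fst = s0,
      (h 0 0).snd = p1, (h 0 1).snd = q1, (h 1 0).snd = r1, (h 1 1).snd = s1 at *
    have two : ∀ x : ZMod 2, x + x = 0 := by decide
    have cases_g : (a0 = 1 ∧ b0 = 0 ∧ c0 = 0 ∧ d0 = 1) ∨ (a0 = 1 ∧ b0 = 1 ∧ c0 = 0 ∧ d0 = 1) ∨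
        (a0 = 1 ∧ b0 = 0 ∧ c0 = 1 ∧ d0 = 1) ∨ (a0 = 0 ∧ b0 = 1 ∧ c0 = 1 ∧ d0 = 0) ∨
        (a0 = 1 ∧ b0 = 1 ∧ c0 = 1 ∧ d0 = 0) ∨ (a0 = 0 ∧ b0 = 1 ∧ c0 = 1 ∧ d0 = 1) := by
      clear g₁ h₀ h₁
      revert a0 b0 c0 d0
      decide
    have := zmod_two_mul_self p0
    have := zmod_two_mul_self q0
    have := zmod_two_mul_self r0
    have := zmod_two_mul_self s0
    rcases cases_g with ⟨rfl, rfl, rfl, rfl⟩ | ⟨rfl, rfl, rfl, rfl⟩ | ⟨rfl, rfl, rfl, rfl⟩ |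
      ⟨rfl, rfl, rfl, rfl⟩ | ⟨rfl, rfl, rfl, rfl⟩ | ⟨rfl, rfl, rfl, rfl⟩ <;> grind

theorem sl2DualNumberCharacter_apply (g : SpecialLinearGroup (Fin 2) (DualNumber (ZMod 2))) :
    sl2DualNumberCharacter g = Multiplicative.ofAdd
    ((g 0 0).snd * (g 1 1).fst + (g 0 1).snd * (g 1 0).fst
      + ((g 0 0).snd * (g 0 1).fst + (g 0 1).snd * (g 0 0).fst)
      + ((g 1 0).snd * (g 1 1).fst + (g 1 1).snd * (g 1 0).fst)) := rfl

/-- Every permutation of the affine plane `𝔽₂²` is affine with invertible linear part. -/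
theorem perm_zmod_two_prod_affine (σ : Equiv.Perm (ZMod 2 × ZMod 2)) :
    ∃ a b c d s t : ZMod 2, a * d - b * c = 1 ∧
      ∀ v, σ v = (a * v.1 + b * v.2 + s, c * v.1 + d * v.2 + t) := by
  have hdet : ∀ t u v : ZMod 2 × ZMod 2, t ≠ u → t ≠ v → u ≠ v →
      (u.1 - t.1) * (v.2 - t.2) - (v.1 - t.1) * (u.2 - t.2) = 1 := by
    decide
  have hsum : ∀ t u v w : ZMod 2 × ZMod 2, t ≠ u ∧ t ≠ v ∧ t ≠ w ∧ u ≠ v ∧ u ≠ w ∧ v ≠ w →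
      w = u + v - t := by
    decide
  have hne {x y : ZMod 2 × ZMod 2} (h : x ≠ y) : σ x ≠ σ y := σ.injective.ne h
  have hw := hsum (σ (0, 0)) (σ (1, 0)) (σ (0, 1)) (σ (1, 1))
    ⟨hne (by decide), hne (by decide), hne (by decide), hne (by decide), hne (by decide),
      hne (by decide)⟩
  refine ⟨_, _, _, _, (σ (0, 0)).1, (σ (0, 0)).2, hdet _ _ _ (hne (x := (0, 0)) (y := (1, 0)) (by decide))
    (hne (y := (0, 1)) (by decide)) (hne (by decide)), fun v => ?_⟩
  have hv : ∀ v : ZMod 2 × ZMod 2, v = (0, 0) ∨ v = (1, 0) ∨ v = (0, 1) ∨ v = (1, 1) := by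
    decide
  rcases hv v with rfl | rfl | rfl | rfl
  · simp
  · simp
  · simp
  · rw [hw]
    ext <;> simp <;> ring

theorem sl2DualNumber_injective :
    Function.Injective (sl2DualNumberAffine.toHomPerm.prod sl2DualNumberCharacter) := by
  rw [injective_iff_map_eq_one]
  intro g hg
  have g₀ := sl2_dualNumber_det_fst g
  have g₁ := sl2_dualNumber_det_snd g
  have hp : ∀ v, sl2DualNumberAct g v = v := fun v =>
    Equiv.congr_fun (congrArg Prod.fst hg) v
  have hc : Multiplicative.toAdd (sl2DualNumberCharacter g) = 0 := congrArg Prod.snd hg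
  have e₀ := hp (0, 0)
  have e₁ := hp (1, 0)
  have e₂ := hp (0, 1)
  simp only [sl2DualNumberAct, sl2DualNumberCharacter_apply,
    toAdd_ofAdd, Prod.mk.injEq, mul_zero, mul_one, zero_add, add_zero] at e₀ e₁ e₂ hc
  ext i j <;> fin_cases i <;> fin_cases j <;> simp <;> grind

theorem sl2DualNumber_surjective :
    Function.Surjective (sl2DualNumberAffine.toHomPerm.prod sl2DualNumberCharacter) := by
  rintro ⟨σ, χ⟩
  obtain ⟨a, b, c, d, s, t, hdet, hσ⟩ := perm_zmod_two_prod_affine σ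
  obtain ⟨r, hr⟩ : ∃ r, r = Multiplicative.toAdd χ + s + t := ⟨_, rfl⟩
  have two : ∀ x : ZMod 2, x + x = 0 := by decide
  let M : Matrix (Fin 2) (Fin 2) (DualNumber (ZMod 2)) :=
    !![(a, r * a + s * c), (b, r * b + s * d); (c, t * a + r * c), (d, t * b + r * d)]
  have hM : M.det = 1 := by
    rw [det_fin_two]
    refine TrivSqZeroExt.ext hdet ?_
    · change a * (t * b + r * d) + (r * a + s * c) * d
        - (b * (t * a + r * c) + (r * b + s * d) * c) = 0
      grind
  refine ⟨⟨M, hM⟩, Prod.ext (Equiv.ext fun v => ?_) ?_⟩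
  · rw [hσ]
    change (a * v.1 + b * v.2 + ((r * a + s * c) * b + (r * b + s * d) * a),
      c * v.1 + d * v.2 + ((t * a + r * c) * d + (t * b + r * d) * c)) = _
    ext <;> dsimp only <;> grind
  · change (r * a + s * c) * d + (r * b + s * d) * c
      + ((r * a + s * c) * b + (r * b + s * d) * a)
      + ((t * a + r * c) * d + (t * b + r * d) * c) = Multiplicative.toAdd χ
    generalize Multiplicative.toAdd χ = x at *
    grind

/-- SL₂(𝔽₂[x]/(x²)) ≅ S₄ × ℤ/2ℤ. -/
theorem sl2_dualNumber_f2_iso_s4_prod_z2 :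
    Nonempty (Matrix.SpecialLinearGroup (Fin 2) (DualNumber (ZMod 2)) ≃*
      Equiv.Perm (Fin 4) × Multiplicative (ZMod 2)) := by
  have e : ZMod 2 × ZMod 2 ≃ Fin 4 := Fintype.equivFinOfCardEq rfl
  exact ⟨(MulEquiv.ofBijective _ ⟨sl2DualNumber_injective, sl2DualNumber_surjective⟩).trans
    (e.permCongrHom.prodCongr (MulEquiv.refl _))⟩
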